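/- Lemma 4.1 (superposition principle). Let φ be a growth function of uniformly upper type q₀ for some q₀ ∈ (0,1) (so that I(φ) ∈ (0,1)). Then there exists a constant C > 0, depending only on φ, with the following property: whenever {f_j}_{j∈ℤ₊} is a sequence of measurable functions on ℝⁿ and η > 0 are such that S := Σ_{j∈ℤ₊} sup_{α>0} φ({x : |f_j(x)| > α}, α/η) < ∞, then for every β > 0, φ({x ∈ ℝⁿ : Σ_{j∈ℤ₊} |f_j(x)| > β}, β/η) ≤ C·S. -/

import Mathlib

open MeasureTheory Metric Set Filter
open scoped ENNReal NNReal Topology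

noncomputable section

/-- Euclidean space `ℝⁿ`. -/
abbrev En (n : ℕ) := EuclideanSpace ℝ (Fin n)

/-- `Ω` is homogeneous of degree zero. -/
def HomogeneousZero {n : ℕ} (Ω : En n → ℝ) : Prop :=
  ∀ s : ℝ, 0 < s → ∀ x : En n, x ≠ 0 → Ω (s • x) = Ω x

/-- `Ω ∈ Lip_α(S^{n-1})`. -/
def LipSphere {n : ℕ} (α : ℝ) (Ω : En n → ℝ) : Prop :=
  ∃ L > 0, ∀ x y : En n, ‖x‖ = 1 → ‖y‖ = 1 → |Ω x - Ω y| ≤ L * ‖x - y‖ ^ α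

/-- `Ω` is bounded on the unit sphere. -/
def BddSphere {n : ℕ} (Ω : En n → ℝ) : Prop :=
  ∃ M : ℝ, ∀ x : En n, ‖x‖ = 1 → |Ω x| ≤ M

/-- The cancellation condition `∫_{S^{n-1}} Ω dσ = 0`. -/
def SphereCancel {n : ℕ} (Ω : En n → ℝ) : Prop :=
  ∫ ξ : sphere (0 : En n) 1, Ω ξ ∂((volume : Measure (En n)).toSphere) = 0

/-- The truncated kernel operator `F_t f (y) = ∫_{|y-z|<t} Ω(y-z)|y-z|^{ρ-n} f(z) dz`. -/
def Fker {n : ℕ} (Ω : En n → ℝ) (ρ : ℝ) (f : En n → ℝ) (t : ℝ) (y : En n) : ℝ :=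
  ∫ z in {z : En n | ‖y - z‖ < t}, Ω (y - z) * ‖y - z‖ ^ (ρ - n) * f z

/-- The parametric Littlewood–Paley area integral `μ^ρ_{Ω,S}`. -/
def muS {n : ℕ} (Ω : En n → ℝ) (ρ : ℝ) (f : En n → ℝ) (x : En n) : ℝ≥0∞ :=
  (∫⁻ p in {p : En n × ℝ | ‖p.1 - x‖ < p.2},
      ENNReal.ofReal (|Fker Ω ρ f p.2 p.1| ^ 2 * p.2 ^ (-((n : ℝ) + 2 * ρ + 1)))) ^ (1/2 : ℝ)

/-- The parametric Littlewood–Paley function `μ^{ρ,*}_{Ω,λ}`. -/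
def muLam {n : ℕ} (Ω : En n → ℝ) (ρ lam : ℝ) (f : En n → ℝ) (x : En n) : ℝ≥0∞ :=
  (∫⁻ p in {p : En n × ℝ | 0 < p.2},
      ENNReal.ofReal ((p.2 / (p.2 + ‖x - p.1‖)) ^ (lam * n) *
        (|Fker Ω ρ f p.2 p.1| ^ 2 * p.2 ^ (-((n : ℝ) + 2 * ρ + 1))))) ^ (1/2 : ℝ)

/-- Musielak–Orlicz function. -/
structure IsMusielakOrlicz {n : ℕ} (φ : En n → ℝ → ℝ) : Prop where
  measurable : ∀ t : ℝ, Measurable fun x => φ x t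
  nonneg : ∀ x t, 0 ≤ φ x t
  mono : ∀ x, MonotoneOn (φ x) (Ici 0)
  zero : ∀ x, φ x 0 = 0
  pos : ∀ x t, 0 < t → 0 < φ x t
  tendsto_atTop : ∀ x, Tendsto (φ x) atTop atTop

/-- `φ` is of uniformly lower type `p`. -/
def UniformlyLowerType {n : ℕ} (φ : En n → ℝ → ℝ) (p : ℝ) : Prop :=
  ∃ C > 0, ∀ (x : En n) (t s : ℝ), 0 ≤ t → 0 < s → s ≤ 1 →
    φ x (s * t) ≤ C * s ^ p * φ x t

/-- `φ` is of uniformly upper type `p`. -/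
def UniformlyUpperType {n : ℕ} (φ : En n → ℝ → ℝ) (p : ℝ) : Prop :=
  ∃ C > 0, ∀ (x : En n) (t s : ℝ), 0 ≤ t → 1 ≤ s →
    φ x (s * t) ≤ C * s ^ p * φ x t

/-- The uniformly Muckenhoupt condition `𝔸_q`. -/
def UniformA {n : ℕ} (φ : En n → ℝ → ℝ) (q : ℝ) : Prop :=
  if q = 1 then
    ∃ C > 0, ∀ (x₀ : En n) (r : ℝ), 0 < r → ∀ t : ℝ, 0 < t →
      ((volume (ball x₀ r)).toReal)⁻¹ * (∫ x in ball x₀ r, φ x t) *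
        essSup (fun y => (φ y t)⁻¹) (volume.restrict (ball x₀ r)) ≤ C
  else
    ∃ C > 0, ∀ (x₀ : En n) (r : ℝ), 0 < r → ∀ t : ℝ, 0 < t →
      ((volume (ball x₀ r)).toReal)⁻¹ * (∫ x in ball x₀ r, φ x t) *
        (((volume (ball x₀ r)).toReal)⁻¹ *
          ∫ y in ball x₀ r, (φ y t) ^ (-(1 / (q - 1)))) ^ (q - 1) ≤ C

/-- The uniformly Muckenhoupt condition `𝔸_∞`. -/
def UniformAinfty {n : ℕ} (φ : En n → ℝ → ℝ) : Prop :=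
  ∃ q : ℝ, 1 ≤ q ∧ UniformA φ q

/-- A growth function in the sense of Ky. -/
structure GrowthFunction {n : ℕ} (φ : En n → ℝ → ℝ) : Prop where
  mo : IsMusielakOrlicz φ
  ainfty : UniformAinfty φ
  lower : ∃ p : ℝ, 0 < p ∧ p ≤ 1 ∧ UniformlyLowerType φ p
  upper : UniformlyUpperType φ 1

/-- `φ(E,t) = ∫_E φ(x,t) dx` (as an extended nonnegative real). -/
def phiSetE {n : ℕ} (φ : En n → ℝ → ℝ) (E : Set (En n)) (t : ℝ) : ℝ≥0∞ :=
  ∫⁻ x in E, ENNReal.ofReal (φ x t)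

/-- `φ(E,t) = ∫_E φ(x,t) dx` (Bochner integral). -/
def phiSet {n : ℕ} (φ : En n → ℝ → ℝ) (E : Set (En n)) (t : ℝ) : ℝ :=
  ∫ x in E, φ x t

/-- The Musielak–Orlicz (quasi-)norm `‖g‖_{L^φ}` of a real-valued function. -/
def LphiNorm {n : ℕ} (φ : En n → ℝ → ℝ) (g : En n → ℝ) : ℝ :=
  sInf {η : ℝ | 0 < η ∧ ∫⁻ x, ENNReal.ofReal (φ x (|g x| / η)) ≤ 1}

/-- Extension of `φ x` to `[0,∞]`, with value `∞` at `∞`. -/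
def phiOfE {n : ℕ} (φ : En n → ℝ → ℝ) (x : En n) (t : ℝ≥0∞) : ℝ≥0∞ :=
  if t = ∞ then ∞ else ENNReal.ofReal (φ x t.toReal)

/-- The Musielak–Orlicz (quasi-)norm of an `ℝ≥0∞`-valued function. -/
def LphiNormE {n : ℕ} (φ : En n → ℝ → ℝ) (g : En n → ℝ≥0∞) : ℝ :=
  sInf {η : ℝ | 0 < η ∧ ∫⁻ x, phiOfE φ x (g x / ENNReal.ofReal η) ≤ 1}

/-- Membership `g ∈ L^φ` for an `ℝ≥0∞`-valued function. -/
def MemLphiE {n : ℕ} (φ : En n → ℝ → ℝ) (g : En n → ℝ≥0∞) : Prop :=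
  ∃ η > 0, ∫⁻ x, phiOfE φ x (g x / ENNReal.ofReal η) < ∞

/-- The weak Musielak–Orlicz quasi-norm `‖g‖_{WL^φ}` of a real-valued function. -/
def WLphiNorm {n : ℕ} (φ : En n → ℝ → ℝ) (g : En n → ℝ) : ℝ :=
  sInf {η : ℝ | 0 < η ∧ ∀ t : ℝ, 0 < t → phiSetE φ {x | t < |g x|} (t / η) ≤ 1}

/-- The weak Musielak–Orlicz quasi-norm of an `ℝ≥0∞`-valued function. -/
def WLphiNormE {n : ℕ} (φ : En n → ℝ → ℝ) (g : En n → ℝ≥0∞) : ℝ :=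
  sInf {η : ℝ | 0 < η ∧ ∀ t : ℝ, 0 < t →
    phiSetE φ {x | ENNReal.ofReal t < g x} (t / η) ≤ 1}

/-- The normalized family `S_m` of Schwartz functions. -/
def SchwartzSm (n m : ℕ) : Set (En n → ℝ) :=
  {ψ | (∃ Ψ : SchwartzMap (En n) ℝ, ψ = ⇑Ψ) ∧
    ∀ k : ℕ, k ≤ m + 1 → ∀ d : Fin k → Fin n, ∀ x : En n,
      (1 + ‖x‖) ^ ((m + 2) * (n + 1)) *
        |iteratedFDeriv ℝ k ψ x (fun j => EuclideanSpace.single (d j) (1 : ℝ))| ≤ 1}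

/-- The dilation `ψ_t(z) = t^{-n} ψ(z/t)`. -/
def dilat {n : ℕ} (ψ : En n → ℝ) (t : ℝ) (z : En n) : ℝ :=
  (t ^ n)⁻¹ * ψ (t⁻¹ • z)

/-- Convolution `(f * g)(y) = ∫ f(z) g(y - z) dz`. -/
def convol {n : ℕ} (f g : En n → ℝ) (y : En n) : ℝ :=
  ∫ z, f z * g (y - z)

/-- The non-tangential grand maximal function `f_m^*`. -/
def grandMax {n : ℕ} (m : ℕ) (f : En n → ℝ) (x : En n) : ℝ≥0∞ :=
  ⨆ (ψ : En n → ℝ) (_ : ψ ∈ SchwartzSm n m) (t : ℝ) (_ : 0 < t)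
    (y : En n) (_ : ‖y - x‖ < t), ENNReal.ofReal |convol f (dilat ψ t) y|

/-- The critical uniformly lower type index `i(φ)`. -/
def iIndex {n : ℕ} (φ : En n → ℝ → ℝ) : ℝ :=
  sSup {p : ℝ | UniformlyLowerType φ p}

/-- The critical weight index `q(φ)`. -/
def qIndex {n : ℕ} (φ : En n → ℝ → ℝ) : ℝ :=
  sInf {q : ℝ | 1 ≤ q ∧ UniformA φ q}

/-- `m(φ) = ⌊n (q(φ)/i(φ) - 1)⌋`. -/
def mIndex {n : ℕ} (φ : En n → ℝ → ℝ) : ℤ :=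
  ⌊(n : ℝ) * (qIndex φ / iIndex φ - 1)⌋

/-- The grand maximal function `f^* = f^*_{m(φ)}`. -/
def fstar {n : ℕ} (φ : En n → ℝ → ℝ) (f : En n → ℝ) : En n → ℝ≥0∞ :=
  grandMax (mIndex φ).toNat f

/-- `‖f‖_{H^φ} = ‖f^*‖_{L^φ}`. -/
def HphiNorm {n : ℕ} (φ : En n → ℝ → ℝ) (f : En n → ℝ) : ℝ :=
  LphiNormE φ (fstar φ f)

/-- `b` has vanishing moments up to order `s`. -/
def VanishingMoments {n : ℕ} (b : En n → ℝ) (s : ℕ) : Prop :=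
  ∀ γ : Fin n → ℕ, (∑ i, γ i) ≤ s → ∫ x : En n, b x * ∏ i, (x i) ^ (γ i) = 0

/-- The norm `‖a‖_{L^q_φ(B)}` appearing in the definition of atoms. -/
def atomNorm {n : ℕ} (φ : En n → ℝ → ℝ) (q : ℝ≥0∞) (a : En n → ℝ)
    (x₀ : En n) (r : ℝ) : ℝ :=
  if q = ∞ then (eLpNorm a ⊤ (volume.restrict (ball x₀ r))).toReal
  else sSup ((fun t => ((phiSet φ (ball x₀ r) t)⁻¹ *
      ∫ x in ball x₀ r, |a x| ^ q.toReal * φ x t) ^ (1 / q.toReal)) '' Ioi (0:ℝ))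

/-- A `(φ, q, s)`-atom associated with the ball `B(x₀, r)`. -/
def IsPhiAtom {n : ℕ} (φ : En n → ℝ → ℝ) (q : ℝ≥0∞) (s : ℕ) (a : En n → ℝ)
    (x₀ : En n) (r : ℝ) : Prop :=
  0 < r ∧ Function.support a ⊆ ball x₀ r ∧
    atomNorm φ q a x₀ r ≤ (LphiNorm φ ((ball x₀ r).indicator fun _ => (1:ℝ)))⁻¹ ∧
    VanishingMoments a s

end

/-- Dyadic bound `min a 1 ≤ ∑ₖ 2 · 2⁻ᵏ 1_{a > 2⁻ᵏ}`, scaled by `b`. -/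
theorem min_div_one_le_tsum_dyadic {a b : ℝ} (ha : 0 ≤ a) (hb : 0 < b) :
    ENNReal.ofReal (min (a / b) 1) ≤
      ∑' k : ℕ, if b / 2 ^ k < a then ENNReal.ofReal (2 * (1 / 2) ^ k) else 0 := by
  rcases ha.eq_or_lt with rfl | ha
  · simp
  rcases lt_or_ge b a with hba | hab
  · refine le_trans ?_ (ENNReal.le_tsum 0)
    simp only [pow_zero, div_one, hba, if_true]
    exact ENNReal.ofReal_le_ofReal ((min_le_right _ _).trans (by norm_num))
  · obtain ⟨k, hk₁, hk₂⟩ := exists_nat_pow_near_of_lt_one (div_pos ha hb)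
      ((div_le_one hb).2 hab) (by norm_num : (0 : ℝ) < 1 / 2) (by norm_num)
    refine le_trans ?_ (ENNReal.le_tsum (k + 1))
    have hlt : b / 2 ^ (k + 1) < a := by
      have := (lt_div_iff₀ hb).1 hk₁
      rw [one_div, inv_pow] at this
      rwa [div_eq_inv_mul]
    rw [if_pos hlt]
    refine ENNReal.ofReal_le_ofReal ((min_le_left _ _).trans (hk₂.trans_eq ?_))
    rw [pow_succ]
    ring

theorem one_le_tsum_min_of_lt_tsum {ι : Type*} {a : ι → ℝ} {b : ℝ}
    (hb : 0 < b) (h : ENNReal.ofReal b < ∑' j, ENNReal.ofReal (a j)) :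
    1 ≤ ∑' j, ENNReal.ofReal (min (a j / b) 1) := by
  by_cases hj : ∃ j, b < a j
  · obtain ⟨j, hj⟩ := hj
    refine le_trans ?_ (ENNReal.le_tsum j)
    rw [min_eq_right ((one_le_div hb).2 hj.le), ENNReal.ofReal_one]
  · push Not at hj
    have hmin : ∀ j, ENNReal.ofReal (min (a j / b) 1) =
        ENNReal.ofReal (a j) / ENNReal.ofReal b := fun j => by
      rw [min_eq_left ((div_le_one hb).2 (hj j)), ENNReal.ofReal_div_of_pos hb]
    simp_rw [hmin, div_eq_mul_inv, ENNReal.tsum_mul_right]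
    rw [← div_eq_mul_inv, ENNReal.le_div_iff_mul_le (by simp [hb]) (by simp), one_mul]
    exact h.le

theorem dyadic_mul_phiSetE_le {n : ℕ} {φ : En n → ℝ → ℝ} {q C : ℝ} (hC : 0 ≤ C)
    (hφ : ∀ (x : En n) (t s : ℝ), 0 ≤ t → 1 ≤ s → φ x (s * t) ≤ C * s ^ q * φ x t)
    (E : Set (En n)) {t : ℝ} (ht : 0 ≤ t) (k : ℕ) :
    ENNReal.ofReal (2 * (1 / 2) ^ k) * phiSetE φ E t ≤
      ENNReal.ofReal (2 * C) * ENNReal.ofReal (2 ^ (q - 1)) ^ k * phiSetE φ E (t / 2 ^ k) := by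
  have hr : (0 : ℝ) ≤ 2 ^ (q - 1) := by positivity
  unfold phiSetE
  rw [← ENNReal.ofReal_pow hr, ← ENNReal.ofReal_mul (by positivity),
    ← lintegral_const_mul' _ _ ENNReal.ofReal_ne_top,
    ← lintegral_const_mul' _ _ ENNReal.ofReal_ne_top]
  refine lintegral_mono fun x => ?_
  rw [← ENNReal.ofReal_mul (by positivity), ← ENNReal.ofReal_mul (by positivity)]
  refine ENNReal.ofReal_le_ofReal ?_
  have h := hφ x (t / 2 ^ k) (2 ^ k) (by positivity) (one_le_pow₀ (by norm_num))
  rw [mul_div_cancel₀ _ (by positivity)] at h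
  have hpow : (2 : ℝ) ^ (q - 1) = 2 ^ q * (1 / 2) := by
    rw [Real.rpow_sub_one (by norm_num)]
    ring
  have hcomm : ((2 : ℝ) ^ k) ^ q = (2 ^ q) ^ k := by
    rw [← Real.rpow_natCast, ← Real.rpow_mul (by norm_num), mul_comm,
      Real.rpow_mul (by norm_num), Real.rpow_natCast]
  rw [hcomm] at h
  calc 2 * (1 / 2) ^ k * φ x t
      ≤ 2 * (1 / 2) ^ k * (C * (2 ^ q) ^ k * φ x (t / 2 ^ k)) := by gcongr
    _ = 2 * C * (2 ^ (q - 1)) ^ k * φ x (t / 2 ^ k) := by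
      rw [hpow, mul_pow]
      ring

theorem phiSetE_tsum_le {n : ℕ} {φ : En n → ℝ → ℝ} {t : ℝ} (hφ : Measurable fun x => φ x t)
    {f : ℕ → En n → ℝ} (hf : ∀ j, Measurable (f j)) {β : ℝ} (hβ : 0 < β) :
    phiSetE φ {x | ENNReal.ofReal β < ∑' j, ENNReal.ofReal |f j x|} t ≤
      ∑' (j : ℕ) (k : ℕ),
        ENNReal.ofReal (2 * (1 / 2) ^ k) * phiSetE φ {x | β / 2 ^ k < |f j x|} t := by
  have hset : ∀ j k, MeasurableSet {x | β / 2 ^ k < |f j x|} := fun j k =>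
    measurableSet_lt measurable_const (hf j).abs
  have hφ' : Measurable fun x => ENNReal.ofReal (φ x t) := hφ.ennreal_ofReal
  have hmeas : ∀ j k, Measurable fun x => ENNReal.ofReal (2 * (1 / 2) ^ k) *
      {x | β / 2 ^ k < |f j x|}.indicator (fun x => ENNReal.ofReal (φ x t)) x := fun j k =>
    (hφ'.indicator (hset j k)).const_mul _
  have hint : ∀ j k, ENNReal.ofReal (2 * (1 / 2) ^ k) * phiSetE φ {x | β / 2 ^ k < |f j x|} t =
      ∫⁻ x, ENNReal.ofReal (2 * (1 / 2) ^ k) *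
        {x | β / 2 ^ k < |f j x|}.indicator (fun x => ENNReal.ofReal (φ x t)) x := fun j k => by
    rw [lintegral_const_mul _ (hφ'.indicator (hset j k)), lintegral_indicator (hset j k), phiSetE]
  simp_rw [hint]
  calc phiSetE φ {x | ENNReal.ofReal β < ∑' j, ENNReal.ofReal |f j x|} t
      ≤ ∫⁻ x in {x | ENNReal.ofReal β < ∑' j, ENNReal.ofReal |f j x|},
          ∑' (j : ℕ) (k : ℕ), ENNReal.ofReal (2 * (1 / 2) ^ k) *
            {x | β / 2 ^ k < |f j x|}.indicator (fun x => ENNReal.ofReal (φ x t)) x := by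
        refine setLIntegral_mono' (measurableSet_lt measurable_const
          (Measurable.tsum fun j => (hf j).abs.ennreal_ofReal)) fun x hx => ?_
        have h₁ := (one_le_tsum_min_of_lt_tsum hβ hx).trans
          (ENNReal.tsum_le_tsum fun j => min_div_one_le_tsum_dyadic (abs_nonneg (f j x)) hβ)
        have h₂ := mul_le_mul_left h₁ (ENNReal.ofReal (φ x t))
        rw [one_mul] at h₂
        refine h₂.trans_eq ?_
        simp_rw [← ENNReal.tsum_mul_right, indicator_apply, mem_ofPred_eq, ite_mul, mul_ite,
          zero_mul, mul_zero]
    _ ≤ ∫⁻ x, ∑' (j : ℕ) (k : ℕ), ENNReal.ofReal (2 * (1 / 2) ^ k) *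
            {x | β / 2 ^ k < |f j x|}.indicator (fun x => ENNReal.ofReal (φ x t)) x :=
        setLIntegral_le_lintegral _ _
    _ = _ := by
        rw [lintegral_tsum fun j => (Measurable.tsum (hmeas j)).aemeasurable]
        exact tsum_congr fun j => lintegral_tsum fun k => (hmeas j k).aemeasurable

theorem stmt8 {n : ℕ} (φ : En n → ℝ → ℝ) (hφ : GrowthFunction φ)
    (q₀ : ℝ) (hq₀0 : 0 < q₀) (hq₀1 : q₀ < 1) (hupper : UniformlyUpperType φ q₀) :
    ∃ C > 0, ∀ (f : ℕ → En n → ℝ) (η : ℝ), 0 < η → (∀ j, Measurable (f j)) →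
      (∑' j, ⨆ (a : ℝ) (_ : 0 < a), phiSetE φ {x | a < |f j x|} (a / η)) ≠ ∞ →
      ∀ β : ℝ, 0 < β →
        phiSetE φ {x | ENNReal.ofReal β < ∑' j, ENNReal.ofReal |f j x|} (β / η) ≤
          ENNReal.ofReal C *
            ∑' j, ⨆ (a : ℝ) (_ : 0 < a), phiSetE φ {x | a < |f j x|} (a / η) := by
  obtain ⟨C, hC, hup⟩ := hupper
  have hr : (2 : ℝ) ^ (q₀ - 1) < 1 := Real.rpow_lt_one_of_one_lt_of_neg (by norm_num) (by linarith)
  have hr' : 0 < 1 - (2 : ℝ) ^ (q₀ - 1) := sub_pos.2 hr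
  refine ⟨2 * C * (1 - 2 ^ (q₀ - 1))⁻¹, by positivity, fun f η hη hf _ β hβ => ?_⟩
  refine (phiSetE_tsum_le (hφ.mo.measurable _) hf hβ).trans ?_
  rw [← ENNReal.tsum_mul_left]
  refine ENNReal.tsum_le_tsum fun j => ?_
  have hgeom : ENNReal.ofReal (2 * C * (1 - 2 ^ (q₀ - 1))⁻¹) =
      ∑' k : ℕ, ENNReal.ofReal (2 * C) * ENNReal.ofReal (2 ^ (q₀ - 1)) ^ k := by
    rw [ENNReal.tsum_mul_left, ENNReal.tsum_geometric, ENNReal.ofReal_mul (by positivity),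
      ENNReal.ofReal_inv_of_pos hr', ENNReal.ofReal_sub _ (by positivity), ENNReal.ofReal_one]
  rw [hgeom, ← ENNReal.tsum_mul_right]
  refine ENNReal.tsum_le_tsum fun k => ?_
  refine (dyadic_mul_phiSetE_le hC.le hup _ (by positivity) k).trans ?_
  gcongr
  rw [div_right_comm]
  exact le_iSup₂_of_le (f := fun (a : ℝ) (_ : 0 < a) => phiSetE φ {x | a < |f j x|} (a / η))
    (β / 2 ^ k) (by positivity) le_rfl
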